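/- arXiv:2408.14581 — 2 statements merged into one kernel-verified Lean document; each statement's English description precedes it below -/
import Mathlib

section
/- If a sequent Γ ⇒ Δ has a PLK-proof, then Γ ⇒ Δ has a contraction-free PLK-proof (which may use the cut rule). -/
/-- Propositional formulas over a countably infinite set of variables. -/
inductive Fml : Type
  | var : ℕ → Fml
  | neg : Fml → Fml
  | conj : Fml → Fml → Fml
  | disj : Fml → Fml → Fml
  | imp : Fml → Fml → Fml
  deriving DecidableEq

/-- Tags for the rules of PLK; the cut tag records the cut formula. -/
inductive PLKRule : Type
  | ax | wl | wr | cl | cr | el | er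
  | negL | negR | andL | andR | orL | orR | impL | impR
  | cut : Fml → PLKRule
  deriving DecidableEq

/-- PLK-proofs of sequents (pairs of lists of formulas), where only rules
satisfying `ok` may be used.  `PLKDeriv ok Γ Δ` says the sequent Γ ⇒ Δ has a
proof tree built from axioms using rules allowed by `ok`. -/
inductive PLKDeriv (ok : PLKRule → Prop) : List Fml → List Fml → Prop
  | ax (n : ℕ) : ok .ax → PLKDeriv ok [.var n] [.var n]
  | wl (A : Fml) (Γ Δ : List Fml) : ok .wl →
      PLKDeriv ok Γ Δ → PLKDeriv ok (A :: Γ) Δ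
  | wr (A : Fml) (Γ Δ : List Fml) : ok .wr →
      PLKDeriv ok Γ Δ → PLKDeriv ok Γ (Δ ++ [A])
  | cl (A : Fml) (Γ Δ : List Fml) : ok .cl →
      PLKDeriv ok (A :: A :: Γ) Δ → PLKDeriv ok (A :: Γ) Δ
  | cr (A : Fml) (Γ Δ : List Fml) : ok .cr →
      PLKDeriv ok Γ (Δ ++ [A, A]) → PLKDeriv ok Γ (Δ ++ [A])
  | el (A B : Fml) (Γ Θ Δ : List Fml) : ok .el →
      PLKDeriv ok (Γ ++ A :: B :: Θ) Δ → PLKDeriv ok (Γ ++ B :: A :: Θ) Δ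
  | er (A B : Fml) (Γ Δ Θ : List Fml) : ok .er →
      PLKDeriv ok Γ (Δ ++ A :: B :: Θ) → PLKDeriv ok Γ (Δ ++ B :: A :: Θ)
  | negL (A : Fml) (Γ Δ : List Fml) : ok .negL →
      PLKDeriv ok Γ (Δ ++ [A]) → PLKDeriv ok (.neg A :: Γ) Δ
  | negR (A : Fml) (Γ Δ : List Fml) : ok .negR →
      PLKDeriv ok (A :: Γ) Δ → PLKDeriv ok Γ (Δ ++ [.neg A])
  | andL₁ (A B : Fml) (Γ Δ : List Fml) : ok .andL →
      PLKDeriv ok (A :: Γ) Δ → PLKDeriv ok (.conj A B :: Γ) Δ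
  | andL₂ (A B : Fml) (Γ Δ : List Fml) : ok .andL →
      PLKDeriv ok (B :: Γ) Δ → PLKDeriv ok (.conj A B :: Γ) Δ
  | andR (A B : Fml) (Γ Δ : List Fml) : ok .andR →
      PLKDeriv ok Γ (Δ ++ [A]) → PLKDeriv ok Γ (Δ ++ [B]) →
      PLKDeriv ok Γ (Δ ++ [.conj A B])
  | orL (A B : Fml) (Γ Δ : List Fml) : ok .orL →
      PLKDeriv ok (A :: Γ) Δ → PLKDeriv ok (B :: Γ) Δ →
      PLKDeriv ok (.disj A B :: Γ) Δ
  | orR₁ (A B : Fml) (Γ Δ : List Fml) : ok .orR →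
      PLKDeriv ok Γ (Δ ++ [A]) → PLKDeriv ok Γ (Δ ++ [.disj A B])
  | orR₂ (A B : Fml) (Γ Δ : List Fml) : ok .orR →
      PLKDeriv ok Γ (Δ ++ [B]) → PLKDeriv ok Γ (Δ ++ [.disj A B])
  | impL (A B : Fml) (Γ Δ : List Fml) : ok .impL →
      PLKDeriv ok Γ (Δ ++ [A]) → PLKDeriv ok (B :: Γ) Δ →
      PLKDeriv ok (.imp A B :: Γ) Δ
  | impR (A B : Fml) (Γ Δ : List Fml) : ok .impR →
      PLKDeriv ok (A :: Γ) (Δ ++ [B]) → PLKDeriv ok Γ (Δ ++ [.imp A B])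
  | cut (A : Fml) (Γ Δ : List Fml) : ok (.cut A) →
      PLKDeriv ok Γ (Δ ++ [A]) → PLKDeriv ok (A :: Γ) Δ → PLKDeriv ok Γ Δ

/-- Γ ⇒ Δ is PLK-provable (all rules allowed). -/
def PLKProvable (Γ Δ : List Fml) : Prop := PLKDeriv (fun _ => True) Γ Δ

/-- The rule `r` is not an instance of cut. -/
def noCut (r : PLKRule) : Prop := ∀ A : Fml, r ≠ PLKRule.cut A

/-- The rule `r` is not an instance of contraction (CL or CR). -/
def noContraction (r : PLKRule) : Prop := r ≠ PLKRule.cl ∧ r ≠ PLKRule.cr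

/-- The rule `r` is neither contraction nor cut. -/
def noConNoCut (r : PLKRule) : Prop := noContraction r ∧ noCut r

namespace PLKDeriv

variable {ok : PLKRule → Prop} {Γ Γ' Δ Δ' : List Fml}

theorem perm_left (hel : ok .el) (hp : Γ.Perm Γ') (Θ : List Fml)
    (h : PLKDeriv ok (Θ ++ Γ) Δ) : PLKDeriv ok (Θ ++ Γ') Δ := by
  induction hp generalizing Θ with
  | nil => exact h
  | cons A _ ih => simpa using ih (Θ ++ [A]) (by simpa using h)
  | swap A B Ξ => exact el B A Θ Ξ Δ hel h
  | trans _ _ ih₁ ih₂ => exact ih₂ Θ (ih₁ Θ h)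

theorem perm_right (her : ok .er) (hp : Δ.Perm Δ') (Θ : List Fml)
    (h : PLKDeriv ok Γ (Θ ++ Δ)) : PLKDeriv ok Γ (Θ ++ Δ') := by
  induction hp generalizing Θ with
  | nil => exact h
  | cons A _ ih => simpa using ih (Θ ++ [A]) (by simpa using h)
  | swap A B Ξ => exact er B A Γ Θ Ξ her h
  | trans _ _ ih₁ ih₂ => exact ih₂ Θ (ih₁ Θ h)

theorem weaken_left (hwl : ok .wl) (Θ : List Fml) (h : PLKDeriv ok Γ Δ) :
    PLKDeriv ok (Θ ++ Γ) Δ := by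
  induction Θ with
  | nil => exact h
  | cons A Θ ih => exact wl A _ _ hwl ih

theorem weaken_right (hwr : ok .wr) (Θ : List Fml) (h : PLKDeriv ok Γ Δ) :
    PLKDeriv ok Γ (Δ ++ Θ) := by
  induction Θ generalizing Δ with
  | nil => simpa using h
  | cons A Θ ih => simpa using ih (wr A _ _ hwr h)

/-- The generalized axiom `A ⇒ A` is provable without contraction and cut. -/
theorem identity (hok : ∀ r, noConNoCut r → ok r) (A : Fml) : PLKDeriv ok [A] [A] := by
  have hel : ok .el := hok _ (by simp [noConNoCut, noContraction, noCut])
  have her : ok .er := hok _ (by simp [noConNoCut, noContraction, noCut])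
  induction A with
  | var n => exact ax n (hok _ (by simp [noConNoCut, noContraction, noCut]))
  | neg A ih =>
    refine negR A [.neg A] [] (hok _ (by simp [noConNoCut, noContraction, noCut])) ?_
    refine el (.neg A) A [] [] [] hel ?_
    exact negL A [A] [] (hok _ (by simp [noConNoCut, noContraction, noCut])) ih
  | conj A B ihA ihB =>
    have handL : ok .andL := hok _ (by simp [noConNoCut, noContraction, noCut])
    exact andR A B _ [] (hok _ (by simp [noConNoCut, noContraction, noCut]))
      (andL₁ A B [] _ handL ihA) (andL₂ A B [] _ handL ihB)
  | disj A B ihA ihB =>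
    have horR : ok .orR := hok _ (by simp [noConNoCut, noContraction, noCut])
    exact orL A B [] _ (hok _ (by simp [noConNoCut, noContraction, noCut]))
      (orR₁ A B _ [] horR ihA) (orR₂ A B _ [] horR ihB)
  | imp A B ihA ihB =>
    refine impR A B [.imp A B] [] (hok _ (by simp [noConNoCut, noContraction, noCut])) ?_
    refine el (.imp A B) A [] [] [B] hel ?_
    refine impL A B [A] [B] (hok _ (by simp [noConNoCut, noContraction, noCut])) ?_ ?_
    · exact er A B [A] [] [] her
        (wr B _ _ (hok _ (by simp [noConNoCut, noContraction, noCut])) ihA)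
    · exact el A B [] [] [B] hel
        (wl A _ _ (hok _ (by simp [noConNoCut, noContraction, noCut])) ihB)

theorem identity_weakened (hok : ∀ r, noConNoCut r → ok r) (A : Fml) (Γ Δ : List Fml) :
    PLKDeriv ok (A :: Γ) (Δ ++ [A]) := by
  have hid := weaken_right (hok _ (by simp [noConNoCut, noContraction, noCut])) Δ
    (weaken_left (hok _ (by simp [noConNoCut, noContraction, noCut])) Γ (identity hok A))
  have hl := perm_left (hok _ (by simp [noConNoCut, noContraction, noCut]))
    (List.perm_append_singleton A Γ) [] hid
  exact perm_right (hok _ (by simp [noConNoCut, noContraction, noCut]))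
    (List.perm_append_singleton A Δ).symm [] hl

end PLKDeriv

/-- contraction elimination — every PLK-provable sequent has a
contraction-free PLK-proof (possibly using cut). -/
theorem stmt_1 (Γ Δ : List Fml) (h : PLKProvable Γ Δ) :
    PLKDeriv noContraction Γ Δ := by
  have hok : ∀ r, noConNoCut r → noContraction r := fun _ hr => hr.1
  have hid := PLKDeriv.identity_weakened hok
  unfold PLKProvable at h
  induction h with
  | cl A Γ Δ _ _ ih =>
    exact .cut A _ _ (by simp [noContraction]) (hid A Γ Δ) ih
  | cr A Γ Δ _ _ ih =>
    exact .cut A _ _ (by simp [noContraction]) (by simpa using ih) (hid A Γ Δ)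
  | ax n => exact .ax n (by simp [noContraction])
  | wl _ _ _ _ _ ih => exact .wl _ _ _ (by simp [noContraction]) ih
  | wr _ _ _ _ _ ih => exact .wr _ _ _ (by simp [noContraction]) ih
  | el _ _ _ _ _ _ _ ih => exact .el _ _ _ _ _ (by simp [noContraction]) ih
  | er _ _ _ _ _ _ _ ih => exact .er _ _ _ _ _ (by simp [noContraction]) ih
  | negL _ _ _ _ _ ih => exact .negL _ _ _ (by simp [noContraction]) ih
  | negR _ _ _ _ _ ih => exact .negR _ _ _ (by simp [noContraction]) ih
  | andL₁ _ _ _ _ _ _ ih => exact .andL₁ _ _ _ _ (by simp [noContraction]) ih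
  | andL₂ _ _ _ _ _ _ ih => exact .andL₂ _ _ _ _ (by simp [noContraction]) ih
  | andR _ _ _ _ _ _ _ ih₁ ih₂ => exact .andR _ _ _ _ (by simp [noContraction]) ih₁ ih₂
  | orL _ _ _ _ _ _ _ ih₁ ih₂ => exact .orL _ _ _ _ (by simp [noContraction]) ih₁ ih₂
  | orR₁ _ _ _ _ _ _ ih => exact .orR₁ _ _ _ _ (by simp [noContraction]) ih
  | orR₂ _ _ _ _ _ _ ih => exact .orR₂ _ _ _ _ (by simp [noContraction]) ih
  | impL _ _ _ _ _ _ _ ih₁ ih₂ => exact .impL _ _ _ _ (by simp [noContraction]) ih₁ ih₂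
  | impR _ _ _ _ _ _ ih => exact .impR _ _ _ _ (by simp [noContraction]) ih
  | cut A _ _ _ _ _ ih₁ ih₂ => exact .cut A _ _ (by simp [noContraction]) ih₁ ih₂
end

section
/- Rule-elimination theorem for abstract sequent structures: let S be a set, ℛ = {R_i}_{i∈I} a family of rules on S, and let ⊢_ℛ be a provability relation induced by ℛ and ⊢_{ℛ∖{R_k}} a provability relation induced by ℛ ∖ {R_k}, where R_k ∈ ℛ is a non-axiomatic rule. Let (P, 𝔯) be a relation space and v : S → P a function. Suppose: (1) R_i ∩ R_k = ∅ for every R_i ∈ ℛ with R_i ≠ R_k; (2) for every instance of R_k with premises (s_t)_{t∈T} and conclusion s, (v(s_t), v(s)) ∈ 𝔯 for all t ∈ T; (3) every ⊢_ℛ-provable s is either the conclusion of an instance of an axiomatic rule in ℛ, or the conclusion of an instance of some non-axiomatic rule in ℛ whose premises (s_j)_{j∈J} are all ⊢_ℛ-provable and such that (v(s_j), v(s)) ∉ 𝔯 for some j ∈ J; (4) whenever an instance of a rule R_i with R_i ∩ R_k = ∅ has premises (s_j)_{j∈J} and conclusion s with (v(s_j), v(s)) ∉ 𝔯 for some j ∈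 J, and all the s_j are ⊢_ℛ-provable, then all the s_j are ⊢_{ℛ∖{R_k}}-provable. Then R_k is eliminable: every ⊢_ℛ-provable element of S is ⊢_{ℛ∖{R_k}}-provable. -/
/-- An instance of an abstract rule on the set `S` of sequents: a family of
premises (given by the set of its members) together with a conclusion. -/
abbrev AInst (S : Type) := Set S × S

/-- An abstract rule: a set of instances. -/
abbrev ARule (S : Type) := Set (AInst S)

/-- A rule is axiomatic if all of its instances have empty premise family. -/
def Axiomatic {S : Type} (R : ARule S) : Prop := ∀ i ∈ R, i.1 = (∅ : Set S)

/-- `InducedBy ℛ Prov`: the provability relation `Prov` is induced by the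
family of rules `ℛ`:
(i) every conclusion of an instance of an axiomatic rule in ℛ is provable;
(ii) every provable s is either the conclusion of an instance of an axiomatic
rule in ℛ, or the conclusion of an instance of some non-axiomatic rule in ℛ
all of whose premises are provable;
(iii) for every instance of every non-axiomatic rule in ℛ, if all its
premises are provable then so is its conclusion. -/
def InducedBy {S : Type} (ℛ : Set (ARule S)) (Prov : S → Prop) : Prop :=
  (∀ R ∈ ℛ, Axiomatic R → ∀ i ∈ R, Prov i.2) ∧
  (∀ s : S, Prov s →
    (∃ R ∈ ℛ, Axiomatic R ∧ ∃ i ∈ R, i.2 = s) ∨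
    (∃ R ∈ ℛ, ¬ Axiomatic R ∧ ∃ i ∈ R, i.2 = s ∧ ∀ p ∈ i.1, Prov p)) ∧
  (∀ R ∈ ℛ, ¬ Axiomatic R → ∀ i ∈ R, (∀ p ∈ i.1, Prov p) → Prov i.2)

/-- rule-elimination theorem for abstract sequent structures.
Rk is a non-axiomatic rule of the family ℛ (every rule being a nonempty set
of instances), Prov is a provability relation induced by ℛ and Prov' one
induced by ℛ ∖ {Rk}, (P, r) is a relation space and v : S → P. Under the
hypotheses (1)-(4), Rk is eliminable. -/
theorem stmt_18 {S P : Type} (ℛ : Set (ARule S)) (Rk : ARule S)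
    (hne : ∀ R ∈ ℛ, R.Nonempty) (hRk : Rk ∈ ℛ) (hnonax : ¬ Axiomatic Rk)
    (Prov Prov' : S → Prop)
    (hInd : InducedBy ℛ Prov) (hInd' : InducedBy (ℛ \ {Rk}) Prov')
    (r : P → P → Prop) (v : S → P)
    (h1 : ∀ R ∈ ℛ, R ≠ Rk → R ∩ Rk = ∅)
    (h2 : ∀ i ∈ Rk, ∀ p ∈ i.1, r (v p) (v i.2))
    (h3 : ∀ s : S, Prov s →
      (∃ R ∈ ℛ, Axiomatic R ∧ ∃ i ∈ R, i.2 = s) ∨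
      (∃ R ∈ ℛ, ¬ Axiomatic R ∧ ∃ i ∈ R, i.2 = s ∧
        (∀ p ∈ i.1, Prov p) ∧ ∃ p ∈ i.1, ¬ r (v p) (v s)))
    (h4 : ∀ R ∈ ℛ, R ∩ Rk = ∅ → ∀ i ∈ R,
      (∃ p ∈ i.1, ¬ r (v p) (v i.2)) → (∀ p ∈ i.1, Prov p) →
      ∀ p ∈ i.1, Prov' p) :
    ∀ s : S, Prov s → Prov' s := by
  intro s hs
  rcases h3 s hs with ⟨R, hR, hax, i, hi, rfl⟩ | ⟨R, hR, hnax, i, hi, rfl, hprov, p, hp, hnr⟩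
  · have hRne : R ≠ Rk := fun h => hnonax (h ▸ hax)
    exact hInd'.1 R ⟨hR, hRne⟩ hax i hi
  · have hRne : R ≠ Rk := by
      rintro rfl
      exact hnr (h2 i hi p hp)
    exact hInd'.2.2 R ⟨hR, hRne⟩ hnax i hi
      (h4 R hR (h1 R hR hRne) i hi ⟨p, hp, hnr⟩ hprov)
end
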